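/- Let (X,d) be a Polish metric space and p ∈ [1,∞). Let φ and ψ be Borel probability measures on P(X) (the space of Borel probability measures on X) such that ∫_{P(X)} W_p(ρ₀,ρ)^p dφ(ρ) < ∞ and ∫_{P(X)} W_p(ρ₀,ϱ)^p dψ(ϱ) < ∞ for some (hence any) ρ₀ ∈ P(X) with finite p-th moment. Let join(φ) and join(ψ) denote their barycenters. Then W_p(join(φ), join(ψ))^p ≤ inf over couplings η of φ and ψ of ∫_{P(X)×P(X)} W_p(ρ,ϱ)^p dη(ρ,ϱ); that is, W_p(join(φ), join(ψ)) ≤ HW_p(φ,ψ) (hierarchical monotonicity of the Wasserstein distance). -/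

import Mathlib

open MeasureTheory ENNReal

noncomputable section

/-- The set of couplings of two measures: probability measures on the product
whose marginals are the given measures. -/
def Couplings {α β : Type*} [MeasurableSpace α] [MeasurableSpace β]
    (μ : Measure α) (ν : Measure β) : Set (Measure (α × β)) :=
  {π | π.map Prod.fst = μ ∧ π.map Prod.snd = ν}

/-- The `p`-Wasserstein cost
`W_p(μ,ν) = (inf over couplings π of ∫ d(x,y)^p dπ)^(1/p)`. -/
def Wp {X : Type*} [MeasurableSpace X] [PseudoEMetricSpace X] (p : ℝ)
    (μ ν : Measure X) : ℝ≥0∞ :=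
  (⨅ π ∈ Couplings μ ν, ∫⁻ z : X × X, edist z.1 z.2 ^ p ∂π) ^ (1 / p)

/-- The Hierarchical Wasserstein cost of order `p`:
`HW_p(φ,ψ) = (inf over couplings η of φ,ψ of ∫ W_p(ρ,ϱ)^p dη)^(1/p)`. -/
def HWp {X : Type*} [MeasurableSpace X] [PseudoEMetricSpace X] (p : ℝ)
    (φ ψ : Measure (Measure X)) : ℝ≥0∞ :=
  (⨅ η ∈ Couplings φ ψ, ∫⁻ ρϱ : Measure X × Measure X, Wp p ρϱ.1 ρϱ.2 ^ p ∂η) ^ (1 / p)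

/-- The risk of hypothesis `h` relative to `h'` under loss `l` and measure `μ`. -/
def risk {X : Type*} [MeasurableSpace X] (l : ℝ × ℝ → ℝ) (μ : Measure X)
    (h h' : X → ℝ) : ℝ :=
  ∫ x, l (h x, h' x) ∂μ

section

open Set Filter Topology NNReal

/-- The atomic measure with finitely many atoms and rational weights given by `q`. -/
def ratAtomic {α : Type*} [MeasurableSpace α] (q : α →₀ NNRat) : Measure α :=
  ∑ z ∈ q.support, ((q z : ℝ≥0) : ℝ≥0∞) • Measure.dirac z

instance {α : Type*} [MeasurableSpace α] (q : α →₀ NNRat) : IsFiniteMeasure (ratAtomic q) := by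
  refine ⟨?_⟩
  simp only [ratAtomic, Measure.finsetSum_apply, Measure.smul_apply, measure_univ, smul_eq_mul,
    mul_one]
  exact ENNReal.sum_lt_top.2 fun z _ ↦ ENNReal.coe_lt_top

lemma lintegral_ratAtomic {α : Type*} [MeasurableSpace α] [MeasurableSingletonClass α]
    (q : α →₀ NNRat) (f : α → ℝ≥0∞) :
    ∫⁻ z, f z ∂(ratAtomic q) = ∑ z ∈ q.support, ((q z : ℝ≥0) : ℝ≥0∞) * f z := by
  simp only [ratAtomic, lintegral_finsetSum_measure, lintegral_smul_measure, lintegral_dirac,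
    smul_eq_mul]

lemma lintegral_ratAtomic_ne_top {α : Type*} [MeasurableSpace α] [MeasurableSingletonClass α]
    (q : α →₀ NNRat) {f : α → ℝ≥0∞} (hf : ∀ z, f z ≠ ⊤) :
    ∫⁻ z, f z ∂(ratAtomic q) ≠ ⊤ := by
  rw [lintegral_ratAtomic]
  exact ENNReal.sum_ne_top.2 fun z _ ↦ ENNReal.mul_ne_top ENNReal.coe_ne_top (hf z)

lemma exists_nnrat_le_sub_mul_le {a b ε : ℝ≥0∞} (ha : a ≠ ⊤) (hb : b ≠ ⊤) (hε : ε ≠ 0) :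
    ∃ q : NNRat, ((q : ℝ≥0) : ℝ≥0∞) ≤ a ∧ (a - ((q : ℝ≥0) : ℝ≥0∞)) * b ≤ ε := by
  rcases eq_or_ne a 0 with rfl | ha0
  · exact ⟨0, by simp, by simp⟩
  rcases eq_or_ne b 0 with rfl | hb0
  · exact ⟨0, by simp, by simp⟩
  have h : a - ε / b < a := ENNReal.sub_lt_self ha ha0 (ENNReal.div_ne_zero.2 ⟨hε, hb⟩)
  obtain ⟨q, hq0, hq1, hq2⟩ := ENNReal.lt_iff_exists_rat_btwn.1 h
  lift q to NNRat using hq0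
  have hcast : (q : ℝ≥0) = Real.toNNReal ((q : ℚ) : ℝ) := by
    apply NNReal.eq
    rw [Real.coe_toNNReal _ (by positivity)]
    push_cast
    rfl
  refine ⟨q, by rw [hcast]; exact hq2.le, ?_⟩
  rw [hcast, ← ENNReal.le_div_iff_mul_le (Or.inl hb0) (Or.inl hb), tsub_le_iff_left]
  exact tsub_le_iff_right.1 hq1.le

/-- A finite measure on a countable space dominates finitely supported measures with rational
weights whose complement is arbitrarily small in the sense of integrating a given function. -/
lemma exists_eq_ratAtomic_add {α : Type*} [Countable α] [MeasurableSpace α]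
    [MeasurableSingletonClass α] (γ : Measure α) [IsFiniteMeasure γ] {f : α → ℝ≥0∞}
    (hf : ∀ z, f z ≠ ⊤) (hfi : ∫⁻ z, f z ∂γ ≠ ⊤) {δ : ℝ≥0∞} (hδ : δ ≠ 0) :
    ∃ (q : α →₀ NNRat) (γ' : Measure α), γ = ratAtomic q + γ' ∧ ∫⁻ z, f z ∂γ' ≤ δ := by
  classical
  have hδ2 : δ / 2 ≠ 0 := by simpa using hδ
  obtain ⟨e, he, hes⟩ := ENNReal.exists_pos_sum_of_countable' hδ2 α
  choose q hq hqe using fun z ↦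
    exists_nnrat_le_sub_mul_le (measure_ne_top γ {z}) (hf z) (he z).ne'
  rw [lintegral_countable'] at hfi
  obtain ⟨F, hF⟩ := ((ENNReal.tendsto_tsum_compl_atTop_zero hfi).eventually
    (ge_mem_nhds (pos_iff_ne_zero.2 hδ2))).exists
  set r : α →₀ NNRat := Finsupp.indicator F (fun z _ ↦ q z) with hr
  have hrz : ∀ z, r z = if z ∈ F then q z else 0 := fun z ↦ by
    simp [hr, Finsupp.indicator_apply]
  have hle : ∀ z, ((r z : ℝ≥0) : ℝ≥0∞) ≤ γ {z} := fun z ↦ by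
    rw [hrz]
    split_ifs
    · exact hq z
    · simp
  refine ⟨r, Measure.sum fun z ↦ (γ {z} - ((r z : ℝ≥0) : ℝ≥0∞)) • Measure.dirac z, ?_, ?_⟩
  · refine Measure.ext_of_singleton fun z ↦ ?_
    rw [Measure.add_apply, Measure.sum_smul_dirac_singleton]
    have : ratAtomic r {z} = ((r z : ℝ≥0) : ℝ≥0∞) := by
      rw [← lintegral_indicator_one (measurableSet_singleton z), lintegral_ratAtomic]
      simp only [indicator, mem_singleton_iff, Pi.one_apply, mul_ite, mul_one, mul_zero]
      rw [Finset.sum_ite_eq' r.support z]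
      split_ifs with h
      · rfl
      · rw [Finsupp.notMem_support_iff.1 h]; simp
    rw [this, add_tsub_cancel_of_le (hle z)]
  · rw [lintegral_sum_measure]
    simp only [lintegral_smul_measure, lintegral_dirac, smul_eq_mul]
    calc ∑' z, (γ {z} - ((r z : ℝ≥0) : ℝ≥0∞)) * f z
        ≤ ∑' z, (e z + indicator {z | z ∉ F} (fun z ↦ f z * γ {z}) z) := by
          refine ENNReal.tsum_le_tsum fun z ↦ ?_
          rw [hrz]
          by_cases hz : z ∈ F
          · simpa [hz] using hqe z
          · simp [hz, mul_comm]
      _ = ∑' z, e z + ∑' z : {z | z ∉ F}, f z * γ {(z : α)} := by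
          rw [ENNReal.tsum_add, ← tsum_subtype]
      _ ≤ δ / 2 + δ / 2 := add_le_add hes.le hF
      _ = δ := ENNReal.add_halves δ

/-- A sub-coupling of two measures of equal mass extends to a coupling, and the
extra cost is controlled by the residual integrals of a function `w` such that
`c (x, y) ≤ w x + w y`. -/
lemma exists_coupling_of_subcoupling {ι : Type*} [MeasurableSpace ι]
    {μ ν : Measure ι} [IsFiniteMeasure μ] [IsFiniteMeasure ν] (hμν : μ univ = ν univ)
    (κ : Measure (ι × ι)) [IsFiniteMeasure κ] (hκ₁ : κ.map Prod.fst ≤ μ)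
    (hκ₂ : κ.map Prod.snd ≤ ν) {c : ι × ι → ℝ≥0∞} {w : ι → ℝ≥0∞} (hw : Measurable w)
    (hc : ∀ z, c z ≤ w z.1 + w z.2) {e : ℝ≥0∞}
    (hwκ₁ : ∫⁻ i, w i ∂(κ.map Prod.fst) ≠ ⊤) (hwκ₂ : ∫⁻ i, w i ∂(κ.map Prod.snd) ≠ ⊤)
    (hwμ : ∫⁻ i, w i ∂μ ≤ ∫⁻ i, w i ∂(κ.map Prod.fst) + e)
    (hwν : ∫⁻ i, w i ∂ν ≤ ∫⁻ i, w i ∂(κ.map Prod.snd) + e) :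
    ∃ γ ∈ Couplings μ ν, ∫⁻ z, c z ∂γ ≤ ∫⁻ z, c z ∂κ + (e + e) := by
  set μ' := μ - κ.map Prod.fst
  set ν' := ν - κ.map Prod.snd
  have hμ : μ' + κ.map Prod.fst = μ := Measure.sub_add_cancel_of_le hκ₁
  have hν : ν' + κ.map Prod.snd = ν := Measure.sub_add_cancel_of_le hκ₂
  have e1 : ∫⁻ i, w i ∂μ' ≤ e := by
    rw [← hμ, lintegral_add_measure, add_comm] at hwμ
    exact (ENNReal.add_le_add_iff_left hwκ₁).1 hwμ
  have e2 : ∫⁻ i, w i ∂ν' ≤ e := by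
    rw [← hν, lintegral_add_measure, add_comm] at hwν
    exact (ENNReal.add_le_add_iff_left hwκ₂).1 hwν
  have hmass : μ' univ = ν' univ := by
    rw [← hμ, ← hν, Measure.add_apply, Measure.add_apply,
      Measure.map_apply measurable_fst .univ, Measure.map_apply measurable_snd .univ,
      preimage_univ, preimage_univ] at hμν
    exact (ENNReal.add_left_inj (measure_ne_top κ univ)).1 hμν
  rcases eq_or_ne (μ' univ) 0 with h0 | h0
  · refine ⟨κ, ⟨?_, ?_⟩, le_self_add⟩
    · have : μ' = 0 := Measure.measure_univ_eq_zero.1 h0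
      rw [← hμ, this, zero_add]
    · have : ν' = 0 := Measure.measure_univ_eq_zero.1 (hmass ▸ h0)
      rw [← hν, this, zero_add]
  have hcancel : (μ' univ)⁻¹ * μ' univ = 1 := ENNReal.inv_mul_cancel h0 (measure_ne_top _ _)
  refine ⟨κ + (μ' univ)⁻¹ • μ'.prod ν', ⟨?_, ?_⟩, ?_⟩
  · rw [Measure.map_add _ _ measurable_fst, Measure.map_smul, Measure.map_fst_prod, smul_smul,
      ← hmass, hcancel, one_smul, add_comm, hμ]
  · rw [Measure.map_add _ _ measurable_snd, Measure.map_smul, Measure.map_snd_prod, smul_smul,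
      hcancel, one_smul, add_comm, hν]
  · rw [lintegral_add_measure, lintegral_smul_measure]
    gcongr
    calc (μ' univ)⁻¹ • ∫⁻ z, c z ∂(μ'.prod ν')
        ≤ (μ' univ)⁻¹ • ∫⁻ z, (w z.1 + w z.2) ∂(μ'.prod ν') := by
          gcongr with z
          exact hc z
      _ = (μ' univ)⁻¹ • (μ' univ * ∫⁻ i, w i ∂μ' + μ' univ * ∫⁻ i, w i ∂ν') := by
          congr 1
          rw [lintegral_add_left (f := fun z : ι × ι ↦ w z.1) (hw.comp measurable_fst),
            ← lintegral_map hw measurable_fst, ← lintegral_map hw measurable_snd,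
            Measure.map_fst_prod, Measure.map_snd_prod, lintegral_smul_measure,
            lintegral_smul_measure, ← hmass, smul_eq_mul, smul_eq_mul]
      _ = ∫⁻ i, w i ∂μ' + ∫⁻ i, w i ∂ν' := by
          rw [← mul_add, smul_eq_mul, ← mul_assoc, hcancel, one_mul]
      _ ≤ e + e := add_le_add e1 e2

lemma measure_le_of_forall_singleton_le {α : Type*} [Countable α] [MeasurableSpace α]
    [MeasurableSingletonClass α] {μ ν : Measure α} (h : ∀ a, μ {a} ≤ ν {a}) : μ ≤ ν := by
  rw [← Measure.sum_smul_dirac μ, ← Measure.sum_smul_dirac ν]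
  refine Measure.le_iff.2 fun s hs ↦ ?_
  simp only [Measure.sum_apply _ hs, Measure.smul_apply, smul_eq_mul]
  exact ENNReal.tsum_le_tsum fun a ↦ mul_le_mul_left (h a) _

/-- On a countable space, the optimal transport cost between mixtures is at most the (lower)
integral of the optimal transport costs. -/
lemma iInf_couplings_bind_le {Ω ι : Type*} [MeasurableSpace Ω] [Countable ι] [MeasurableSpace ι]
    [MeasurableSingletonClass ι] (η : Measure Ω) [IsProbabilityMeasure η]
    {A B : Ω → Measure ι} (hA : Measurable A) (hB : Measurable B)
    (hAprob : ∀ᵐ ω ∂η, IsProbabilityMeasure (A ω)) (hBprob : ∀ᵐ ω ∂η, IsProbabilityMeasure (B ω))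
    {c : ι × ι → ℝ≥0∞} {w : ι → ℝ≥0∞} (hw : ∀ i, w i ≠ ⊤) (hc : ∀ z, c z ≤ w z.1 + w z.2)
    (hAw : ∀ᵐ ω ∂η, ∫⁻ i, w i ∂(A ω) ≠ ⊤) (hBw : ∀ᵐ ω ∂η, ∫⁻ i, w i ∂(B ω) ≠ ⊤) :
    ⨅ γ ∈ Couplings (η.bind A) (η.bind B), ∫⁻ z, c z ∂γ ≤
      ∫⁻ ω, ⨅ γ ∈ Couplings (A ω) (B ω), ∫⁻ z, c z ∂γ ∂η := by
  have hwm : Measurable w := measurable_of_countable w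
  refine ENNReal.le_of_forall_pos_le_add fun δ' hδ' _ ↦ ?_
  obtain ⟨δ, hδ0, hδδ⟩ : ∃ δ : ℝ≥0∞, δ ≠ 0 ∧ δ + (δ + δ) ≤ δ' := by
    refine ⟨(δ' : ℝ≥0∞) / 3, by simpa using hδ'.ne', ?_⟩
    rw [← add_assoc, ENNReal.add_thirds]
  have : Nonempty (ι × ι →₀ NNRat) := ⟨0⟩
  obtain ⟨q, hq⟩ := exists_surjective_nat (ι × ι →₀ NNRat)
  set m : ℕ → Measure (ι × ι) := fun n ↦ ratAtomic (q n)
  have hwm₁ : ∀ n, ∫⁻ i, w i ∂((m n).map Prod.fst) ≠ ⊤ := fun n ↦ by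
    rw [lintegral_map hwm measurable_fst]
    exact lintegral_ratAtomic_ne_top _ fun _ ↦ hw _
  have hwm₂ : ∀ n, ∫⁻ i, w i ∂((m n).map Prod.snd) ≠ ⊤ := fun n ↦ by
    rw [lintegral_map hwm measurable_snd]
    exact lintegral_ratAtomic_ne_top _ fun _ ↦ hw _
  set K : ℕ → ℝ≥0∞ := fun n ↦ ∫⁻ z, c z ∂(m n)
  -- parameters for which `m n` is a sub-coupling with small residual
  set E : ℕ → Set Ω := fun n ↦
    {ω | ((∀ i, (m n).map Prod.fst {i} ≤ A ω {i}) ∧ (∀ i, (m n).map Prod.snd {i} ≤ B ω {i})) ∧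
      (∫⁻ i, w i ∂(A ω) ≤ ∫⁻ i, w i ∂((m n).map Prod.fst) + δ ∧
        ∫⁻ i, w i ∂(B ω) ≤ ∫⁻ i, w i ∂((m n).map Prod.snd) + δ)} with hE
  have hEm : ∀ n, MeasurableSet (E n) := fun n ↦ by
    have hAi : ∀ i, Measurable fun ω ↦ A ω {i} := fun i ↦
      (Measure.measurable_coe (measurableSet_singleton i)).comp hA
    have hBi : ∀ i, Measurable fun ω ↦ B ω {i} := fun i ↦
      (Measure.measurable_coe (measurableSet_singleton i)).comp hB
    have hAl := (Measure.measurable_lintegral hwm).comp hA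
    have hBl := (Measure.measurable_lintegral hwm).comp hB
    refine .inter (.inter ?_ ?_) (.inter ?_ ?_)
    · exact measurableSet_setOfPred.2 (.forall fun i ↦ measurableSet_setOfPred.1 <|
        measurableSet_le measurable_const (hAi i))
    · exact measurableSet_setOfPred.2 (.forall fun i ↦ measurableSet_setOfPred.1 <|
        measurableSet_le measurable_const (hBi i))
    · exact measurableSet_le hAl measurable_const
    · exact measurableSet_le hBl measurable_const
  classical
  set H : Ω → ℝ≥0∞ := fun ω ↦ ⨅ n, if ω ∈ E n then K n else ⊤
  have hHm : Measurable H := .iInf fun n ↦ .ite (hEm n) measurable_const measurable_const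
  have key : ∀ ω, IsProbabilityMeasure (A ω) → IsProbabilityMeasure (B ω) →
      ∫⁻ i, w i ∂(A ω) ≠ ⊤ → ∫⁻ i, w i ∂(B ω) ≠ ⊤ → ∀ γ ∈ Couplings (A ω) (B ω),
      ∃ n, ω ∈ E n ∧ K n ≤ ∫⁻ z, c z ∂γ := by
    intro ω _ _ hAω hBω γ hγ
    have : IsFiniteMeasure γ := by
      refine ⟨?_⟩
      rw [← preimage_univ (f := Prod.fst), ← Measure.map_apply measurable_fst .univ, hγ.1]
      exact measure_lt_top _ _
    have hsplit : ∀ κ : Measure (ι × ι), ∫⁻ z, (w z.1 + w z.2) ∂κ =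
        ∫⁻ z, w z.1 ∂κ + ∫⁻ z, w z.2 ∂κ := fun κ ↦
      lintegral_add_left (f := fun z : ι × ι ↦ w z.1) (hwm.comp measurable_fst) _
    obtain ⟨r, γ', hγr, hγ'⟩ := exists_eq_ratAtomic_add γ (f := fun z ↦ w z.1 + w z.2)
      (fun z ↦ ENNReal.add_ne_top.2 ⟨hw _, hw _⟩) (by
        rw [hsplit, ← lintegral_map hwm measurable_fst, ← lintegral_map hwm measurable_snd,
          hγ.1, hγ.2]
        exact ENNReal.add_ne_top.2 ⟨hAω, hBω⟩) hδ0
    obtain ⟨n, rfl⟩ := hq r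
    have hle : m n ≤ γ := by
      conv_rhs => rw [hγr]
      exact Measure.le_add_right le_rfl
    rw [hsplit] at hγ'
    refine ⟨n, ⟨⟨fun i ↦ ?_, fun i ↦ ?_⟩, ?_, ?_⟩, lintegral_mono' hle le_rfl⟩
    · rw [← hγ.1]
      exact Measure.map_mono hle measurable_fst _
    · rw [← hγ.2]
      exact Measure.map_mono hle measurable_snd _
    · rw [← hγ.1, lintegral_map hwm measurable_fst, lintegral_map hwm measurable_fst, hγr,
        lintegral_add_measure]
      gcongr
      exact le_self_add.trans hγ'
    · rw [← hγ.2, lintegral_map hwm measurable_snd, lintegral_map hwm measurable_snd, hγr,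
        lintegral_add_measure]
      gcongr
      exact le_add_self.trans hγ'
  have hHJ : ∀ᵐ ω ∂η, H ω ≤ ⨅ γ ∈ Couplings (A ω) (B ω), ∫⁻ z, c z ∂γ := by
    filter_upwards [hAprob, hBprob, hAw, hBw] with ω h1 h2 h3 h4
    refine le_iInf₂ fun γ hγ ↦ ?_
    obtain ⟨n, hn, hKn⟩ := key ω h1 h2 h3 h4 γ hγ
    exact (iInf_le _ n).trans (by rwa [if_pos hn])
  set F : ℕ → Set Ω := fun n ↦ E n ∩ {ω | K n ≤ H ω + δ}
  have hFm : ∀ n, MeasurableSet (F n) := fun n ↦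
    (hEm n).inter (measurableSet_le measurable_const (hHm.add_const δ))
  have hcover : ∀ᵐ ω ∂η, ω ∈ ⋃ n, F n := by
    filter_upwards [hAprob, hBprob, hAw, hBw] with ω h1 h2 h3 h4
    obtain ⟨n, hn, -⟩ := key ω h1 h2 h3 h4 ((A ω).prod (B ω))
      ⟨by simp [Measure.map_fst_prod], by simp [Measure.map_snd_prod]⟩
    by_cases hHtop : H ω = ⊤
    · exact mem_iUnion.2 ⟨n, hn, by simp [hHtop]⟩
    · obtain ⟨k, hk⟩ := iInf_lt_iff.1 (ENNReal.lt_add_right hHtop hδ0)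
      by_cases hkE : ω ∈ E k
      · rw [if_pos hkE] at hk
        exact mem_iUnion.2 ⟨k, hkE, hk.le⟩
      · simp [if_neg hkE] at hk
  set D : ℕ → Set Ω := disjointed F
  have hDm : ∀ n, MeasurableSet (D n) := fun n ↦ .disjointed hFm n
  have hDF : ∀ n, D n ⊆ F n := fun n ↦ disjointed_subset F n
  have hηD : Measure.sum (fun n ↦ η.restrict (D n)) = η := by
    rw [← Measure.restrict_iUnion (disjoint_disjointed F) hDm, iUnion_disjointed]
    exact Measure.restrict_eq_self_of_ae_mem hcover
  have hmass : ∀ {C : Ω → Measure ι}, Measurable C → (∀ᵐ ω ∂η, IsProbabilityMeasure (C ω)) →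
      ∀ n, (η.restrict (D n)).bind C univ = η (D n) := fun {C} hC hCp n ↦ by
    rw [Measure.bind_apply .univ hC.aemeasurable]
    calc ∫⁻ ω, C ω univ ∂(η.restrict (D n)) = ∫⁻ _, 1 ∂(η.restrict (D n)) :=
          lintegral_congr_ae ((ae_restrict_of_ae hCp).mono fun ω h ↦ h.measure_univ)
      _ = η (D n) := by simp
  have hdom : ∀ {C : Ω → Measure ι}, Measurable C → ∀ (n : ℕ) (κ : Measure ι),
      (∀ ω ∈ D n, ∀ i, κ {i} ≤ C ω {i}) → η (D n) • κ ≤ (η.restrict (D n)).bind C :=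
    fun {C} hC n κ h ↦ by
      refine measure_le_of_forall_singleton_le fun i ↦ ?_
      rw [Measure.bind_apply (measurableSet_singleton i) hC.aemeasurable, Measure.smul_apply,
        smul_eq_mul, mul_comm, ← setLIntegral_const]
      exact setLIntegral_mono' (hDm n) fun ω hω ↦ h ω hω i
  have hmom : ∀ {C : Ω → Measure ι}, Measurable C → ∀ (n : ℕ) (κ : Measure ι),
      (∀ ω ∈ D n, ∫⁻ i, w i ∂(C ω) ≤ ∫⁻ i, w i ∂κ + δ) →
      ∫⁻ i, w i ∂((η.restrict (D n)).bind C) ≤ ∫⁻ i, w i ∂(η (D n) • κ) + η (D n) * δ :=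
    fun {C} hC n κ h ↦ by
      rw [Measure.lintegral_bind hC.aemeasurable hwm.aemeasurable, lintegral_smul_measure,
        smul_eq_mul, ← mul_add, mul_comm, ← setLIntegral_const]
      exact setLIntegral_mono' (hDm n) h
  have hex : ∀ n, ∃ γ ∈ Couplings ((η.restrict (D n)).bind A) ((η.restrict (D n)).bind B),
      ∫⁻ z, c z ∂γ ≤ η (D n) * K n + (η (D n) * δ + η (D n) * δ) := by
    intro n
    have hAn := hmass hA hAprob n
    have hBn := hmass hB hBprob n
    have : IsFiniteMeasure ((η.restrict (D n)).bind A) := ⟨hAn ▸ measure_lt_top _ _⟩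
    have : IsFiniteMeasure ((η.restrict (D n)).bind B) := ⟨hBn ▸ measure_lt_top _ _⟩
    have : IsFiniteMeasure (η (D n) • m n) := Measure.smul_finite _ (measure_ne_top _ _)
    obtain ⟨γ, hγ, hγc⟩ := exists_coupling_of_subcoupling (hAn.trans hBn.symm) (η (D n) • m n)
      (by
        rw [Measure.map_smul]
        exact hdom hA n _ fun ω hω ↦ (hDF n hω).1.1.1)
      (by
        rw [Measure.map_smul]
        exact hdom hB n _ fun ω hω ↦ (hDF n hω).1.1.2) hwm hc (e := η (D n) * δ)
      (by
        rw [Measure.map_smul, lintegral_smul_measure]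
        exact ENNReal.mul_ne_top (measure_ne_top _ _) (hwm₁ n))
      (by
        rw [Measure.map_smul, lintegral_smul_measure]
        exact ENNReal.mul_ne_top (measure_ne_top _ _) (hwm₂ n))
      (by
        rw [Measure.map_smul]
        exact hmom hA n _ fun ω hω ↦ (hDF n hω).1.2.1)
      (by
        rw [Measure.map_smul]
        exact hmom hB n _ fun ω hω ↦ (hDF n hω).1.2.2)
    exact ⟨γ, hγ, by rwa [lintegral_smul_measure] at hγc⟩
  choose γ hγ hγc using hex
  have hbind : ∀ {C : Ω → Measure ι}, Measurable C →
      Measure.sum (fun n ↦ (η.restrict (D n)).bind C) = η.bind C := fun {C} hC ↦ by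
    rw [← Measure.bind_sum _ _ hC.aemeasurable, hηD]
  have hγmem : Measure.sum γ ∈ Couplings (η.bind A) (η.bind B) := by
    refine ⟨?_, ?_⟩
    · rw [Measure.map_sum measurable_fst.aemeasurable, ← hbind hA]
      exact congrArg _ (funext fun n ↦ (hγ n).1)
    · rw [Measure.map_sum measurable_snd.aemeasurable, ← hbind hB]
      exact congrArg _ (funext fun n ↦ (hγ n).2)
  calc ⨅ γ ∈ Couplings (η.bind A) (η.bind B), ∫⁻ z, c z ∂γ
      ≤ ∫⁻ z, c z ∂(Measure.sum γ) := iInf₂_le _ hγmem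
    _ = ∑' n, ∫⁻ z, c z ∂(γ n) := lintegral_sum_measure _ _
    _ ≤ ∑' n, ∫⁻ ω in D n, (H ω + (δ + (δ + δ))) ∂η := by
        refine ENNReal.tsum_le_tsum fun n ↦ (hγc n).trans ?_
        rw [← mul_add, ← mul_add, mul_comm, ← setLIntegral_const]
        refine setLIntegral_mono' (hDm n) fun ω hω ↦ ?_
        rw [← add_assoc (H ω)]
        gcongr
        exact (hDF n hω).2
    _ = ∫⁻ ω, (H ω + (δ + (δ + δ))) ∂η := by rw [← lintegral_sum_measure, hηD]
    _ ≤ ∫⁻ ω, H ω ∂η + δ' := by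
        rw [lintegral_add_right _ measurable_const]
        gcongr
        simpa using hδδ
    _ ≤ _ := by
        exact add_le_add_left (lintegral_mono_ae hHJ) _

open ProbabilityTheory in
/-- The measure is the mixture of its conditionings on the fibers of a countably valued map. -/
lemma bind_cond_preimage_singleton {X ι : Type*} [MeasurableSpace X] [Countable ι]
    [MeasurableSpace ι] [MeasurableSingletonClass ι] (μ : Measure X) [IsFiniteMeasure μ]
    {T : X → ι} (hT : Measurable T) :
    (μ.map T).bind (fun i ↦ cond μ (T ⁻¹' {i})) = μ := by
  refine Measure.ext fun s hs ↦ ?_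
  have hfib : ∀ i, MeasurableSet (T ⁻¹' {i}) := fun i ↦ hT (measurableSet_singleton i)
  rw [Measure.bind_apply hs (measurable_of_countable _).aemeasurable, lintegral_countable']
  calc ∑' i, cond μ (T ⁻¹' {i}) s * μ.map T {i} = ∑' i, μ (T ⁻¹' {i} ∩ s) := by
        congr 1 with i
        rw [Measure.map_apply hT (measurableSet_singleton i), cond_mul_eq_inter (hfib i)]
    _ = μ (⋃ i, T ⁻¹' {i} ∩ s) := by
        refine (measure_iUnion (fun i j hij ↦ ?_) fun i ↦ (hfib i).inter hs).symm
        refine Disjoint.mono inter_subset_left inter_subset_left ?_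
        exact Disjoint.preimage T (by simpa using hij)
    _ = μ s := by
        congr 1
        ext x
        simp

open ProbabilityTheory in
/-- Couplings of the images of `μ` and `ν` under a countably valued map lift to couplings of
`μ` and `ν`. -/
lemma iInf_couplings_le_iInf_couplings_map {X ι : Type*} [MeasurableSpace X] [Countable ι]
    [MeasurableSpace ι] [MeasurableSingletonClass ι] (μ ν : Measure X)
    [IsFiniteMeasure μ] [IsFiniteMeasure ν] {T : X → ι} (hT : Measurable T)
    {h : X × X → ℝ≥0∞} {c : ι × ι → ℝ≥0∞} (hc : ∀ x y, h (x, y) ≤ c (T x, T y)) :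
    ⨅ π ∈ Couplings μ ν, ∫⁻ z, h z ∂π ≤
      ⨅ γ ∈ Couplings (μ.map T) (ν.map T), ∫⁻ z, c z ∂γ := by
  refine le_iInf₂ fun γ hγ ↦ ?_
  have hprob : ∀ (ρ : Measure X) [IsFiniteMeasure ρ],
      ∀ᵐ i ∂(ρ.map T), IsProbabilityMeasure (cond ρ (T ⁻¹' {i})) := fun ρ _ ↦ by
    rw [ae_iff_of_countable]
    intro i hi
    rw [Measure.map_apply hT (measurableSet_singleton i)] at hi
    exact cond_isProbabilityMeasure hi
  have h1 : ∀ᵐ z ∂γ, IsProbabilityMeasure (cond μ (T ⁻¹' {z.1})) :=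
    ae_of_ae_map measurable_fst.aemeasurable (hγ.1 ▸ hprob μ)
  have h2 : ∀ᵐ z ∂γ, IsProbabilityMeasure (cond ν (T ⁻¹' {z.2})) :=
    ae_of_ae_map measurable_snd.aemeasurable (hγ.2 ▸ hprob ν)
  set κ : ι × ι → Measure (X × X) :=
    fun z ↦ (cond μ (T ⁻¹' {z.1})).prod (cond ν (T ⁻¹' {z.2})) with hκ
  have hκm : Measurable κ := measurable_of_countable κ
  have hmem : γ.bind κ ∈ Couplings μ ν := by
    refine ⟨?_, ?_⟩
    · conv_rhs => rw [← bind_cond_preimage_singleton μ hT, ← hγ.1]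
      refine Measure.ext fun s hs ↦ ?_
      rw [Measure.map_apply measurable_fst hs, Measure.bind_apply (measurable_fst hs)
        hκm.aemeasurable, Measure.bind_apply hs (measurable_of_countable _).aemeasurable,
        lintegral_map (measurable_of_countable _) measurable_fst]
      refine lintegral_congr_ae (h2.mono fun z hz ↦ ?_)
      simp only [hκ]
      rw [← prod_univ, Measure.prod_prod, measure_univ, mul_one]
    · conv_rhs => rw [← bind_cond_preimage_singleton ν hT, ← hγ.2]
      refine Measure.ext fun s hs ↦ ?_
      rw [Measure.map_apply measurable_snd hs, Measure.bind_apply (measurable_snd hs)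
        hκm.aemeasurable, Measure.bind_apply hs (measurable_of_countable _).aemeasurable,
        lintegral_map (measurable_of_countable _) measurable_snd]
      refine lintegral_congr_ae (h1.mono fun z hz ↦ ?_)
      simp only [hκ]
      rw [← univ_prod, Measure.prod_prod, measure_univ, one_mul]
  refine (iInf₂_le _ hmem).trans ((Measure.lintegral_bind_le _ _ _).trans (lintegral_mono_ae ?_))
  filter_upwards [h1, h2] with z hz1 hz2
  have hae : ∀ᵐ y ∂(κ z), h y ≤ c z := by
    have a1 : ∀ᵐ y ∂(κ z), y.1 ∈ T ⁻¹' {z.1} := Measure.quasiMeasurePreserving_fst.ae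
      (ae_cond_mem (hT (measurableSet_singleton _)))
    have a2 : ∀ᵐ y ∂(κ z), y.2 ∈ T ⁻¹' {z.2} := Measure.quasiMeasurePreserving_snd.ae
      (ae_cond_mem (hT (measurableSet_singleton _)))
    filter_upwards [a1, a2] with y hy1 hy2
    have := hc y.1 y.2
    rwa [show T y.1 = z.1 from hy1, show T y.2 = z.2 from hy2] at this
  have : IsProbabilityMeasure (κ z) := by
    simp only [hκ]
    infer_instance
  calc ∫⁻ y, h y ∂(κ z) ≤ ∫⁻ _, c z ∂(κ z) := lintegral_mono_ae hae
    _ = c z := by simp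

lemma ENNReal.exists_add_rpow_le {p : ℝ} (hp : 1 ≤ p) {δ : ℝ≥0∞} (hδ0 : δ ≠ 0) (hδ : δ ≠ ⊤) :
    ∃ ε : ℝ≥0∞, ε ≠ 0 ∧ ε ≠ ⊤ ∧ ∀ a : ℝ≥0∞, (a + ε) ^ p ≤ (1 + δ) * a ^ p + δ := by
  have hp0 : 0 < p := by linarith
  have hpinv : 1 / p * p = 1 := by field_simp
  set l : ℝ≥0∞ := (1 + δ) ^ (1 / p) with hl
  have hl1 : 1 < l := ENNReal.one_lt_rpow (ENNReal.lt_add_right ENNReal.one_ne_top hδ0)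
    (by positivity)
  have hltop : l ≠ ⊤ := ENNReal.rpow_ne_top_of_nonneg (by positivity)
    (ENNReal.add_ne_top.2 ⟨ENNReal.one_ne_top, hδ⟩)
  set r := l - 1 with hr
  have hr0 : r ≠ 0 := (tsub_pos_of_lt hl1).ne'
  have hrtop : r ≠ ⊤ := ENNReal.sub_ne_top hltop
  have hs0 : r⁻¹ + 1 ≠ 0 := by simp
  have hs_ne_top : r⁻¹ + 1 ≠ ⊤ :=
    ENNReal.add_ne_top.2 ⟨ENNReal.inv_ne_top.2 hr0, ENNReal.one_ne_top⟩
  have hd0 : δ ^ (1 / p) ≠ 0 := by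
    simp [ENNReal.rpow_eq_zero_iff, hδ0, hδ]
  have hdtop : δ ^ (1 / p) ≠ ⊤ := ENNReal.rpow_ne_top_of_nonneg (by positivity) hδ
  refine ⟨δ ^ (1 / p) * (r⁻¹ + 1)⁻¹, mul_ne_zero hd0 (ENNReal.inv_ne_zero.2 hs_ne_top),
    ENNReal.mul_ne_top hdtop (ENNReal.inv_ne_top.2 hs0), fun a ↦ ?_⟩
  set ε := δ ^ (1 / p) * (r⁻¹ + 1)⁻¹ with hε
  rcases le_total ε (r * a) with h | h
  · refine le_add_right ?_
    calc (a + ε) ^ p ≤ (l * a) ^ p := by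
          gcongr
          calc a + ε ≤ a + r * a := by gcongr
            _ = (1 + r) * a := by ring
            _ = l * a := by rw [hr, add_tsub_cancel_of_le hl1.le]
      _ = (1 + δ) * a ^ p := by
          rw [ENNReal.mul_rpow_of_nonneg _ _ hp0.le, hl, ← ENNReal.rpow_mul, hpinv,
            ENNReal.rpow_one]
  · refine le_add_left ?_
    have ha : a ≤ r⁻¹ * ε := by
      rw [← ENNReal.div_eq_inv_mul, ENNReal.le_div_iff_mul_le (Or.inl hr0) (Or.inl hrtop),
        mul_comm]
      exact h
    calc (a + ε) ^ p ≤ ((r⁻¹ + 1) * ε) ^ p := by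
          gcongr
          rw [add_mul, one_mul]
          gcongr
      _ = δ := by
          rw [hε, mul_comm, mul_assoc, ENNReal.inv_mul_cancel hs0 hs_ne_top, mul_one,
            ← ENNReal.rpow_mul, hpinv, ENNReal.rpow_one]

lemma Wp_rpow {X : Type*} [MeasurableSpace X] [PseudoEMetricSpace X] {p : ℝ} (hp : 1 ≤ p)
    (μ ν : Measure X) :
    Wp p μ ν ^ p = ⨅ π ∈ Couplings μ ν, ∫⁻ z : X × X, edist z.1 z.2 ^ p ∂π := by
  rw [Wp, ← ENNReal.rpow_mul, one_div_mul_cancel (by linarith), ENNReal.rpow_one]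

/-- A random measure at finite mean Wasserstein cost from a measure with finite `p`-th moment has
almost surely finite `p`-th moment. -/
lemma ae_lintegral_edist_rpow_ne_top {X : Type*} [MetricSpace X] [MeasurableSpace X] [BorelSpace X]
    {p : ℝ} (hp : 1 ≤ p) (φ : Measure (Measure X)) (x₀ : X) (ρ₀ : Measure X)
    (hρ₀ : ∫⁻ x, edist x₀ x ^ p ∂ρ₀ < ⊤) (hφ : ∫⁻ ρ, Wp p ρ₀ ρ ^ p ∂φ < ⊤) :
    ∀ᵐ ρ ∂φ, ∫⁻ x, edist x₀ x ^ p ∂ρ ≠ ⊤ := by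
  have hm : Measurable fun x ↦ edist x₀ x ^ p := by fun_prop
  set C : ℝ≥0∞ := 2 ^ (p - 1)
  have hC0 : C ≠ 0 := (ENNReal.rpow_pos (by norm_num) (by norm_num)).ne'
  have hCtop : C ≠ ⊤ := ENNReal.rpow_ne_top_of_nonneg (by linarith) (by norm_num)
  set g : Measure X → ℝ≥0∞ := fun ρ ↦ (∫⁻ x, edist x₀ x ^ p ∂ρ) / C - ∫⁻ x, edist x₀ x ^ p ∂ρ₀
    with hg
  have hgm : Measurable g := ((Measure.measurable_lintegral hm).div_const C).sub_const _
  have hgW : ∀ ρ, g ρ ≤ Wp p ρ₀ ρ ^ p := fun ρ ↦ by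
    rw [Wp_rpow hp]
    refine le_iInf₂ fun π hπ ↦ ?_
    simp only [hg]
    rw [tsub_le_iff_left, ENNReal.div_le_iff' hC0 hCtop, ← hπ.1]
    conv_lhs => rw [← hπ.2]
    rw [lintegral_map hm measurable_fst, lintegral_map hm measurable_snd,
      ← lintegral_add_left (f := fun z : X × X ↦ edist x₀ z.1 ^ p) (hm.comp measurable_fst),
      ← lintegral_const_mul' _ _ hCtop]
    refine lintegral_mono fun z ↦ ?_
    calc edist x₀ z.2 ^ p ≤ (edist x₀ z.1 + edist z.1 z.2) ^ p := by
          gcongr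
          exact edist_triangle _ _ _
      _ ≤ _ := ENNReal.rpow_add_le_mul_rpow_add_rpow _ _ hp
  filter_upwards [ae_lt_top hgm ((lintegral_mono hgW).trans_lt hφ).ne] with ρ hρ htop
  simp [hg, htop, ENNReal.top_div_of_ne_top hCtop, ENNReal.top_sub hρ₀.ne] at hρ

/-- A separable metric space has a measurable countably valued map into a dense sequence moving
points by less than `ε`. -/
lemma exists_measurable_nat_edist_lt {X : Type*} [MetricSpace X]
    [TopologicalSpace.SeparableSpace X] [Nonempty X] [MeasurableSpace X] [BorelSpace X]
    {ε : ℝ≥0∞} (hε : ε ≠ 0) :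
    ∃ (s : ℕ → X) (T : X → ℕ), Measurable T ∧ ∀ x, edist x (s (T x)) < ε := by
  classical
  set s := TopologicalSpace.denseSeq X
  have hex : ∀ x, ∃ n, edist x (s n) < ε := fun x ↦ by
    obtain ⟨_, h, n, rfl⟩ := EMetric.mem_closure_iff.1
      (TopologicalSpace.denseRange_denseSeq X x) ε (pos_iff_ne_zero.2 hε) |>.imp fun _ h ↦ h.symm
    exact ⟨n, h⟩
  refine ⟨s, fun x ↦ Nat.find (hex x), measurable_find hex fun n ↦ ?_,
    fun x ↦ Nat.find_spec (hex x)⟩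
  exact measurableSet_lt (by fun_prop) measurable_const

/-- The optimal transport cost between barycenters is controlled, up to an arbitrarily small error,
by the mean Wasserstein cost of a coupling of the two random measures. -/
lemma iInf_couplings_join_le {X : Type*} [MetricSpace X] [TopologicalSpace.SeparableSpace X]
    [MeasurableSpace X] [BorelSpace X] {p : ℝ} (hp : 1 ≤ p) {φ ψ : Measure (Measure X)}
    [IsProbabilityMeasure φ] [IsProbabilityMeasure ψ]
    (hφprob : ∀ᵐ ρ ∂φ, IsProbabilityMeasure ρ) (hψprob : ∀ᵐ ϱ ∂ψ, IsProbabilityMeasure ϱ)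
    {x₀ : X} (hφm : ∀ᵐ ρ ∂φ, ∫⁻ x, edist x₀ x ^ p ∂ρ ≠ ⊤)
    (hψm : ∀ᵐ ϱ ∂ψ, ∫⁻ x, edist x₀ x ^ p ∂ϱ ≠ ⊤) {η : Measure (Measure X × Measure X)}
    (hη : η ∈ Couplings φ ψ) {δ : ℝ≥0∞} (hδ0 : δ ≠ 0) (hδ : δ ≠ ⊤) :
    ⨅ π ∈ Couplings φ.join ψ.join, ∫⁻ z : X × X, edist z.1 z.2 ^ p ∂π ≤
      (1 + δ) * ∫⁻ z : Measure X × Measure X, Wp p z.1 z.2 ^ p ∂η + δ := by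
  have hp0 : 0 ≤ p := by linarith
  have : Nonempty X := ⟨x₀⟩
  have hηφ : ∀ {P : Measure X → Prop}, (∀ᵐ ρ ∂φ, P ρ) → ∀ᵐ z ∂η, P z.1 := fun h ↦
    ae_of_ae_map measurable_fst.aemeasurable (hη.1.symm ▸ h)
  have hηψ : ∀ {P : Measure X → Prop}, (∀ᵐ ρ ∂ψ, P ρ) → ∀ᵐ z ∂η, P z.2 := fun h ↦
    ae_of_ae_map measurable_snd.aemeasurable (hη.2.symm ▸ h)
  have hηprob : IsProbabilityMeasure η := by
    refine ⟨?_⟩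
    rw [← preimage_univ (f := Prod.fst), ← Measure.map_apply measurable_fst .univ, hη.1,
      measure_univ]
  have hjoinfin : ∀ (χ : Measure (Measure X)) [IsProbabilityMeasure χ],
      (∀ᵐ ρ ∂χ, IsProbabilityMeasure ρ) → IsFiniteMeasure χ.join := fun χ _ h ↦ by
    refine ⟨?_⟩
    rw [Measure.join_apply .univ, lintegral_congr_ae (h.mono fun ρ hρ ↦ hρ.measure_univ)]
    simp
  have := hjoinfin φ hφprob
  have := hjoinfin ψ hψprob
  obtain ⟨ε', hε'0, hε'top, hε'⟩ := ENNReal.exists_add_rpow_le hp hδ0 hδ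
  set ε := ε' / 4 with hε
  have hε0 : ε ≠ 0 := by simpa [hε] using hε'0
  have hεtop : ε ≠ ⊤ := ENNReal.div_ne_top hε'top (by norm_num)
  have hε4 : ε + ε + (ε + ε) = ε' := by
    rw [← two_mul, ← two_mul, ← mul_assoc, hε, show (2 : ℝ≥0∞) * 2 = 4 by norm_num]
    exact ENNReal.mul_div_cancel (by norm_num) (by norm_num)
  obtain ⟨s, T, hT, hs⟩ := exists_measurable_nat_edist_lt (X := X) hε0
  set c : ℕ × ℕ → ℝ≥0∞ := fun z ↦ (edist (s z.1) (s z.2) + (ε + ε)) ^ p with hc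
  set w : ℕ → ℝ≥0∞ := fun i ↦ 2 ^ (p - 1) * (edist x₀ (s i) + ε) ^ p with hw
  have h2top : (2 : ℝ≥0∞) ^ (p - 1) ≠ ⊤ :=
    ENNReal.rpow_ne_top_of_nonneg (by linarith) (by norm_num)
  have hwtop : ∀ i, w i ≠ ⊤ := fun i ↦ ENNReal.mul_ne_top h2top
    (ENNReal.rpow_ne_top_of_nonneg hp0 (ENNReal.add_ne_top.2 ⟨edist_ne_top _ _, hεtop⟩))
  have hcw : ∀ z, c z ≤ w z.1 + w z.2 := fun z ↦ by
    simp only [hc, hw]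
    rw [← mul_add]
    refine le_trans ?_ (ENNReal.rpow_add_le_mul_rpow_add_rpow _ _ hp)
    refine ENNReal.rpow_le_rpow ?_ hp0
    calc edist (s z.1) (s z.2) + (ε + ε)
        ≤ edist x₀ (s z.1) + edist x₀ (s z.2) + (ε + ε) := by
          gcongr
          exact edist_triangle_left _ _ _
      _ = edist x₀ (s z.1) + ε + (edist x₀ (s z.2) + ε) := by ring
  have hwm : Measurable w := measurable_of_countable w
  have hmom : ∀ ρ : Measure X, IsProbabilityMeasure ρ → ∫⁻ x, edist x₀ x ^ p ∂ρ ≠ ⊤ →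
      ∫⁻ i, w i ∂(ρ.map T) ≠ ⊤ := fun ρ _ hρ ↦ by
    rw [lintegral_map hwm hT]
    refine ne_top_of_le_ne_top (b := ∫⁻ x, 2 ^ (p - 1) *
      (2 ^ (p - 1) * (edist x₀ x ^ p + (ε + ε) ^ p)) ∂ρ) ?_ (lintegral_mono fun x ↦ ?_)
    · rw [lintegral_const_mul' _ _ h2top, lintegral_const_mul' _ _ h2top,
        lintegral_add_right _ measurable_const, lintegral_const, measure_univ, mul_one]
      exact ENNReal.mul_ne_top h2top (ENNReal.mul_ne_top h2top (ENNReal.add_ne_top.2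
        ⟨hρ, ENNReal.rpow_ne_top_of_nonneg hp0 (ENNReal.add_ne_top.2 ⟨hεtop, hεtop⟩)⟩))
    · simp only [hw]
      gcongr
      refine le_trans ?_ (ENNReal.rpow_add_le_mul_rpow_add_rpow _ _ hp)
      rw [← add_assoc]
      gcongr
      exact (edist_triangle _ x _).trans (by gcongr; exact (hs x).le)
  have hAm : Measurable fun z : Measure X × Measure X ↦ z.1.map T :=
    (Measure.measurable_map T hT).comp measurable_fst
  have hBm : Measurable fun z : Measure X × Measure X ↦ z.2.map T :=
    (Measure.measurable_map T hT).comp measurable_snd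
  have hφT : φ.join.map T = η.bind fun z ↦ z.1.map T := by
    rw [← Measure.join_map_map hT, ← hη.1, Measure.map_map (Measure.measurable_map T hT)
      measurable_fst]
    rfl
  have hψT : ψ.join.map T = η.bind fun z ↦ z.2.map T := by
    rw [← Measure.join_map_map hT, ← hη.2, Measure.map_map (Measure.measurable_map T hT)
      measurable_snd]
    rfl
  have hup : ∀ x y : X, edist x y ^ p ≤ c (T x, T y) := fun x y ↦ by
    simp only [hc]
    gcongr
    calc edist x y ≤ edist x (s (T x)) + edist (s (T x)) (s (T y)) + edist (s (T y)) y :=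
          edist_triangle4 _ _ _ _
      _ ≤ ε + edist (s (T x)) (s (T y)) + ε := by
          gcongr
          · exact (hs x).le
          · rw [edist_comm]; exact (hs y).le
      _ = _ := by ring
  have hdown : ∀ x y : X, c (T x, T y) ≤ (1 + δ) * edist x y ^ p + δ := fun x y ↦ by
    refine le_trans ?_ (hε' _)
    simp only [hc]
    refine ENNReal.rpow_le_rpow ?_ hp0
    calc edist (s (T x)) (s (T y)) + (ε + ε)
        ≤ edist (s (T x)) x + edist x y + edist y (s (T y)) + (ε + ε) := by
          gcongr
          exact edist_triangle4 _ _ _ _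
      _ ≤ ε + edist x y + ε + (ε + ε) := by
          gcongr
          · rw [edist_comm]; exact (hs x).le
          · exact (hs y).le
      _ = edist x y + (ε + ε + (ε + ε)) := by ring
      _ = edist x y + ε' := by rw [hε4]
  have h1δ0 : 1 + δ ≠ 0 := by simp
  have h1δ : 1 + δ ≠ ⊤ := ENNReal.add_ne_top.2 ⟨ENNReal.one_ne_top, hδ⟩
  have hdisc : ∀ ρ ϱ : Measure X, IsProbabilityMeasure ρ →
      ⨅ γ ∈ Couplings (ρ.map T) (ϱ.map T), ∫⁻ z, c z ∂γ ≤ (1 + δ) * Wp p ρ ϱ ^ p + δ := by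
    intro ρ ϱ hρ
    rw [← tsub_le_iff_right, ← ENNReal.div_le_iff' h1δ0 h1δ, Wp_rpow hp]
    refine le_iInf₂ fun π hπ ↦ ?_
    rw [ENNReal.div_le_iff' h1δ0 h1δ, tsub_le_iff_right]
    have hTT : Measurable (Prod.map T T) := hT.prodMap hT
    have hπprob : π univ = 1 := by
      rw [← preimage_univ (f := Prod.fst), ← Measure.map_apply measurable_fst .univ, hπ.1,
        measure_univ]
    have hmem : π.map (Prod.map T T) ∈ Couplings (ρ.map T) (ϱ.map T) := by
      refine ⟨?_, ?_⟩
      · rw [Measure.map_map measurable_fst hTT, ← hπ.1, Measure.map_map hT measurable_fst]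
        rfl
      · rw [Measure.map_map measurable_snd hTT, ← hπ.2, Measure.map_map hT measurable_snd]
        rfl
    calc ⨅ γ ∈ Couplings (ρ.map T) (ϱ.map T), ∫⁻ z, c z ∂γ
        ≤ ∫⁻ z, c z ∂(π.map (Prod.map T T)) := iInf₂_le _ hmem
      _ ≤ ∫⁻ z, c (T z.1, T z.2) ∂π := lintegral_map_le _ _
      _ ≤ ∫⁻ z, ((1 + δ) * edist z.1 z.2 ^ p + δ) ∂π := lintegral_mono fun z ↦ hdown _ _
      _ = _ := by
        rw [lintegral_add_right _ measurable_const, lintegral_const_mul' _ _ h1δ,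
          lintegral_const, hπprob, mul_one]
  calc ⨅ π ∈ Couplings φ.join ψ.join, ∫⁻ z : X × X, edist z.1 z.2 ^ p ∂π
      ≤ ⨅ γ ∈ Couplings (φ.join.map T) (ψ.join.map T), ∫⁻ z, c z ∂γ :=
        iInf_couplings_le_iInf_couplings_map _ _ hT hup
    _ ≤ ∫⁻ z, ⨅ γ ∈ Couplings (z.1.map T) (z.2.map T), ∫⁻ z, c z ∂γ ∂η := by
        rw [hφT, hψT]
        refine iInf_couplings_bind_le η hAm hBm ?_ ?_ hwtop hcw ?_ ?_
        · exact (hηφ hφprob).mono fun z _ ↦ Measure.isProbabilityMeasure_map hT.aemeasurable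
        · exact (hηψ hψprob).mono fun z _ ↦ Measure.isProbabilityMeasure_map hT.aemeasurable
        · exact (hηφ (hφprob.and hφm)).mono fun z hz ↦ hmom _ hz.1 hz.2
        · exact (hηψ (hψprob.and hψm)).mono fun z hz ↦ hmom _ hz.1 hz.2
    _ ≤ ∫⁻ z, ((1 + δ) * Wp p z.1 z.2 ^ p + δ) ∂η :=
        lintegral_mono_ae ((hηφ hφprob).mono fun z hz ↦ hdisc _ _ hz)
    _ = _ := by
        rw [lintegral_add_right _ measurable_const, lintegral_const_mul' _ _ h1δ,
          lintegral_const, measure_univ, mul_one]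

end

/-- **Hierarchical monotonicity of the Wasserstein distance.**
For Borel probability measures `φ, ψ` on `P(X)` (modelled as measures on the space of
measures that are a.e. probability measures) with finite `p`-th `W_p`-moments,
`W_p(join φ, join ψ) ≤ HW_p(φ, ψ)`. -/
theorem hierarchical_monotonicity_of_Wasserstein
    {X : Type*} [MetricSpace X] [CompleteSpace X] [TopologicalSpace.SeparableSpace X]
    [MeasurableSpace X] [BorelSpace X]
    (p : ℝ) (hp : 1 ≤ p)
    (φ ψ : Measure (Measure X)) [IsProbabilityMeasure φ] [IsProbabilityMeasure ψ]
    (hφprob : ∀ᵐ ρ ∂φ, IsProbabilityMeasure ρ)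
    (hψprob : ∀ᵐ ϱ ∂ψ, IsProbabilityMeasure ϱ)
    (x₀ : X)
    (hφmom : ∃ ρ₀ : Measure X, IsProbabilityMeasure ρ₀ ∧
      (∫⁻ x, edist x₀ x ^ p ∂ρ₀) < ⊤ ∧ (∫⁻ ρ, Wp p ρ₀ ρ ^ p ∂φ) < ⊤)
    (hψmom : ∃ ρ₀ : Measure X, IsProbabilityMeasure ρ₀ ∧
      (∫⁻ x, edist x₀ x ^ p ∂ρ₀) < ⊤ ∧ (∫⁻ ϱ, Wp p ρ₀ ϱ ^ p ∂ψ) < ⊤) :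
    Wp p φ.join ψ.join ≤ HWp p φ ψ := by
  have hp0 : 0 < p := by linarith
  obtain ⟨ρ₁, -, hρ₁, hφ₁⟩ := hφmom
  obtain ⟨ρ₂, -, hρ₂, hψ₂⟩ := hψmom
  have hφm := ae_lintegral_edist_rpow_ne_top hp φ x₀ ρ₁ hρ₁ hφ₁
  have hψm := ae_lintegral_edist_rpow_ne_top hp ψ x₀ ρ₂ hρ₂ hψ₂
  refine ENNReal.rpow_le_rpow (le_iInf₂ fun η hη ↦ ?_) (by positivity)
  set W := ∫⁻ z : Measure X × Measure X, Wp p z.1 z.2 ^ p ∂η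
  rcases eq_or_ne W ⊤ with hWtop | hWtop
  · rw [hWtop]
    exact le_top
  have approx : ∀ δ : ℝ≥0∞, δ ≠ 0 → δ ≠ ⊤ →
      ⨅ π ∈ Couplings φ.join ψ.join, ∫⁻ z : X × X, edist z.1 z.2 ^ p ∂π ≤ (1 + δ) * W + δ :=
    fun δ hδ0 hδtop ↦ iInf_couplings_join_le hp hφprob hψprob hφm hψm hη hδ0 hδtop
  have hlim : Filter.Tendsto (fun δ : ℝ≥0∞ ↦ (1 + δ) * W + δ) (nhdsWithin 0 (Set.Ioi 0))
      (nhds W) := by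
    have : Filter.Tendsto (fun δ : ℝ≥0∞ ↦ (1 + δ) * W + δ) (nhds 0) (nhds ((1 + 0) * W + 0)) :=
      (ENNReal.Tendsto.mul_const (tendsto_const_nhds.add Filter.tendsto_id) (Or.inr hWtop)).add
        Filter.tendsto_id
    simpa using this.mono_left nhdsWithin_le_nhds
  refine ge_of_tendsto hlim ?_
  filter_upwards [self_mem_nhdsWithin, mem_nhdsWithin_of_mem_nhds
    (Iio_mem_nhds (ENNReal.zero_lt_top))] with δ h0 h1
  exact approx δ (ne_of_gt h0) (ne_of_lt h1)
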